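/- arXiv:1401.1108 — 11 statements merged into one kernel-verified Lean document; each statement's English description precedes it below -/
import Mathlib

section
/- Let $a$, $b$ and $n$ be positive integers with $a > b$. Then $(2bn+1)(2bn+3)\binom{2bn}{bn}$ divides $3(a-b)(3a-b)\binom{2an}{an}\binom{an}{bn}$. -/
/-- The integers `4 ^ r * (k + r - 1/2 choose r)`, defined through Pascal's rule. -/
def halfChoose : ℕ → ℕ → ℕ
  | 0, r => Nat.centralBinom r
  | _ + 1, 0 => 1
  | k + 1, r + 1 => halfChoose k (r + 1) + 4 * halfChoose (k + 1) r

theorem halfChoose_zero_left (r : ℕ) : halfChoose 0 r = Nat.centralBinom r := by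
  rw [halfChoose]

theorem halfChoose_zero_right (k : ℕ) : halfChoose k 0 = 1 := by
  cases k <;> simp [halfChoose]

theorem halfChoose_succ_succ (k r : ℕ) :
    halfChoose (k + 1) (r + 1) = halfChoose k (r + 1) + 4 * halfChoose (k + 1) r := by
  rw [halfChoose]

theorem halfChoose_one_left (r : ℕ) :
    halfChoose 1 r = (2 * r + 1) * Nat.centralBinom r := by
  induction r with
  | zero => simp [halfChoose_zero_right]
  | succ r ih =>
    rw [halfChoose_succ_succ, halfChoose_zero_left, ih]
    linarith [Nat.succ_mul_centralBinom_succ r]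

theorem succ_mul_halfChoose_succ (k r : ℕ) :
    (r + 1) * halfChoose k (r + 1) = 2 * (2 * k + 1) * halfChoose (k + 1) r := by
  induction k generalizing r with
  | zero =>
    rw [halfChoose_zero_left, halfChoose_one_left, Nat.succ_mul_centralBinom_succ]
    ring
  | succ k ihk =>
    induction r with
    | zero =>
      have h := ihk 0
      simp only [halfChoose_succ_succ, halfChoose_zero_right] at h ⊢
      linarith
    | succ r ihr =>
      have h := ihk (r + 1)
      rw [halfChoose_succ_succ k (r + 1), halfChoose_succ_succ (k + 1) r]
      linarith

theorem halfChoose_mul_centralBinom (k r : ℕ) :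
    halfChoose k r * Nat.centralBinom k =
      Nat.centralBinom (k + r) * Nat.choose (k + r) k := by
  induction r generalizing k with
  | zero => simp [halfChoose_zero_right]
  | succ r ih =>
    have h₁ := succ_mul_halfChoose_succ k r
    have h₂ := Nat.succ_mul_centralBinom_succ k
    have h₃ := ih (k + 1)
    have h₄ := Nat.choose_succ_right_eq (k + (r + 1)) k
    rw [show k + (r + 1) - k = r + 1 by omega] at h₄
    rw [show k + 1 + r = k + (r + 1) by ring] at h₃
    apply Nat.eq_of_mul_eq_mul_left (Nat.succ_pos r)
    calc (r + 1) * (halfChoose k (r + 1) * Nat.centralBinom k)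
        = halfChoose (k + 1) r * (2 * (2 * k + 1) * Nat.centralBinom k) := by
          rw [← mul_assoc, h₁]; ring
      _ = (k + 1) * (halfChoose (k + 1) r * Nat.centralBinom (k + 1)) := by
          rw [← h₂]; ring
      _ = Nat.centralBinom (k + (r + 1)) *
            (Nat.choose (k + (r + 1)) (k + 1) * (k + 1)) := by rw [h₃]; ring
      _ = (r + 1) * (Nat.centralBinom (k + (r + 1)) * Nat.choose (k + (r + 1)) k) := by
          rw [h₄]; ring

theorem two_mul_add_one_dvd_mul_halfChoose (k r : ℕ) :
    2 * k + 1 ∣ r * halfChoose k r := by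
  cases r with
  | zero => simp
  | succ r => exact ⟨2 * halfChoose (k + 1) r, by rw [succ_mul_halfChoose_succ]; ring⟩

theorem two_mul_add_three_dvd_mul_halfChoose (k r : ℕ) :
    (2 * k + 3 : ℤ) ∣ r * (r - 1) * halfChoose k r := by
  cases r with
  | zero => simp
  | succ r =>
    obtain ⟨c, hc⟩ := two_mul_add_one_dvd_mul_halfChoose (k + 1) r
    have h := succ_mul_halfChoose_succ k r
    zify at hc h
    refine ⟨2 * (2 * k + 1) * c, ?_⟩
    push_cast
    linear_combination (r : ℤ) * h + 2 * (2 * (k : ℤ) + 1) * hc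

theorem two_mul_add_one_dvd_sub_mul_halfChoose (b d n : ℕ) :
    2 * (b * n) + 1 ∣ d * halfChoose (b * n) (d * n) := by
  have h := two_mul_add_one_dvd_mul_halfChoose (b * n) (d * n)
  have hco : Nat.Coprime (2 * (b * n) + 1) n := by
    rw [← mul_assoc]; simp
  refine hco.dvd_of_dvd_mul_left (n := d * halfChoose (b * n) (d * n)) ?_
  rwa [← mul_assoc n d, mul_comm n d]

theorem two_mul_add_three_dvd_three_mul_halfChoose (b d n : ℕ) :
    (2 * (b * n) + 3 : ℤ) ∣
      3 * d * (3 * d + 2 * b) * halfChoose (b * n) (d * n) := by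
  have h := two_mul_add_three_dvd_mul_halfChoose (b * n) (d * n)
  set s := halfChoose (b * n) (d * n)
  push_cast at h
  by_cases h3 : 3 ∣ n
  · obtain ⟨m, rfl⟩ := h3
    have hco : IsCoprime (2 * (b * m) + 1 : ℤ) m := ⟨1, -(2 * b), by ring⟩
    have hd : (2 * (b * m) + 1 : ℤ) ∣ m * (m * (d * (3 * d + 2 * b) * s)) := by
      obtain ⟨c, hc⟩ := h
      push_cast at hc
      refine ⟨c + m * d * s, mul_left_cancel₀ (three_ne_zero (α := ℤ)) ?_⟩
      linear_combination hc
    obtain ⟨c, hc⟩ := hco.dvd_of_dvd_mul_left (hco.dvd_of_dvd_mul_left hd)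
    refine ⟨c, ?_⟩
    push_cast
    linear_combination 3 * hc
  · have hco3 : IsCoprime (3 : ℤ) n :=
      Nat.isCoprime_iff_coprime.2 ((Nat.Prime.coprime_iff_not_dvd Nat.prime_three).2 h3)
    have hco : IsCoprime (2 * (b * n) + 3 : ℤ) n := by
      rw [add_comm, ← mul_assoc]
      exact hco3.add_mul_right_left (2 * b)
    have hd : (2 * (b * n) + 3 : ℤ) ∣ n * (n * (3 * d * (3 * d + 2 * b) * s)) := by
      obtain ⟨c, hc⟩ := h
      refine ⟨9 * c + 3 * n * d * s, ?_⟩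
      linear_combination 9 * hc
    exact hco.dvd_of_dvd_mul_left (hco.dvd_of_dvd_mul_left hd)

theorem amdeberhan_moll (a b n : ℕ) (ha : 0 < a) (hb : 0 < b) (hn : 0 < n)
    (hab : b < a) :
    (2 * b * n + 1) * (2 * b * n + 3) * Nat.choose (2 * b * n) (b * n) ∣
      3 * (a - b) * (3 * a - b) * (Nat.choose (2 * a * n) (a * n) * Nat.choose (a * n) (b * n)) := by
  obtain ⟨d, rfl⟩ := Nat.exists_eq_add_of_le hab.le
  have hS := halfChoose_mul_centralBinom (b * n) (d * n)
  rw [← add_mul, Nat.centralBinom_eq_two_mul_choose, Nat.centralBinom_eq_two_mul_choose] at hS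
  rw [mul_assoc 2 (b + d) n, ← hS, Nat.add_sub_cancel_left,
    show 3 * (b + d) - b = 3 * d + 2 * b by omega, mul_assoc 2 b n,
    ← mul_assoc (3 * d * (3 * d + 2 * b))]
  refine mul_dvd_mul_right ?_ _
  have hco : Nat.Coprime (2 * (b * n) + 1) (2 * (b * n) + 3) := by
    rw [show 2 * (b * n) + 3 = 2 + (2 * (b * n) + 1) by ring]
    simp
  refine hco.mul_dvd_of_dvd_of_dvd ?_ ?_
  · rw [show 3 * d * (3 * d + 2 * b) * halfChoose (b * n) (d * n) =
      d * halfChoose (b * n) (d * n) * (3 * (3 * d + 2 * b)) by ring]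
    exact (two_mul_add_one_dvd_sub_mul_halfChoose b d n).mul_right _
  · exact_mod_cast two_mul_add_three_dvd_three_mul_halfChoose b d n
end

section
/- Let $a$, $b$ and $n$ be positive integers with $a > b$. Then $\binom{2bn}{bn}$ divides $\binom{2an}{an}\binom{an}{bn}$; equivalently, the quantity $T(a,b,n) = \frac{(2an)!\,(bn)!}{(an)!\,((a-b)n)!\,(2bn)!}$ is an integer. -/
theorem Nat.centralBinom_dvd_centralBinom_add_mul_choose (k m : ℕ) :
    m.centralBinom ∣ (m + k).centralBinom * (m + k).choose m := by
  induction k generalizing m with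
  | zero => simp
  | succ k ihk =>
    induction m with
    | zero => simp
    | succ m ihm =>
      obtain ⟨s, hs⟩ := ihm
      obtain ⟨t, ht⟩ := ihk (m + 1)
      rw [show m + 1 + k = m + k + 1 by ring] at ht
      rw [show m + (k + 1) = m + k + 1 by ring] at hs
      rw [show m + 1 + (k + 1) = m + k + 1 + 1 by ring]
      refine ⟨s + 4 * t, Nat.eq_of_mul_eq_mul_left m.succ_pos ?_⟩
      have hm := Nat.succ_mul_centralBinom_succ m
      have hN := Nat.succ_mul_centralBinom_succ (m + k + 1)
      have hc := Nat.add_one_mul_choose_eq (m + k + 1) m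
      have hr := Nat.choose_succ_right_eq (m + k + 1) m
      rw [show m + k + 1 - m = k + 1 by omega] at hr
      generalize (m + k + 1).choose (m + 1) = C' at *
      generalize (m + k + 1).choose m = C at *
      generalize (m + k + 1 + 1).choose (m + 1) = D at *
      generalize (m + k + 1 + 1).centralBinom = c₂ at *
      generalize (m + k + 1).centralBinom = c₁ at *
      generalize (m + 1).centralBinom = d₁ at *
      generalize m.centralBinom = d₀ at *
      zify at *
      linear_combination -c₂ * hc + C * hN - s * hm + 2 * (2 * m + 1) * hs
        + 4 * (m + 1) * ht - 4 * c₁ * hr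

theorem T_is_integer (a b n : ℕ) (ha : 0 < a) (hb : 0 < b) (hn : 0 < n) (hab : b < a) :
    Nat.choose (2 * b * n) (b * n) ∣
      Nat.choose (2 * a * n) (a * n) * Nat.choose (a * n) (b * n) := by
  have h := Nat.centralBinom_dvd_centralBinom_add_mul_choose (a * n - b * n) (b * n)
  rw [Nat.add_sub_cancel' (Nat.mul_le_mul_right n hab.le)] at h
  simpa only [Nat.centralBinom_eq_two_mul_choose, ← mul_assoc] using h
end

section
/- Let $a$, $b$ and $n$ be positive integers with $a > b$. Then $(2bn+3)\binom{2bn}{bn}$ divides $3(a-b)(3a-b)\binom{2an}{an}\binom{an}{bn}$. -/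
open Nat in
/-- The integrality of `(2(b+d))! b! / ((2b)! (b+d)! d!)`. -/
theorem exists_mul_factorial_eq (d b : ℕ) :
    ∃ f : ℕ, f * ((2 * b)! * (b + d)! * d !) = (2 * (b + d))! * b ! := by
  induction d generalizing b with
  | zero => exact ⟨1, by simp⟩
  | succ d ihd =>
    induction b with
    | zero =>
      refine ⟨(d + 1).centralBinom, ?_⟩
      have h := Nat.choose_mul_factorial_mul_factorial (n := 2 * (d + 1)) (k := d + 1) (by omega)
      rw [show 2 * (d + 1) - (d + 1) = d + 1 by omega] at h
      simp only [Nat.centralBinom, mul_zero, factorial_zero, zero_add, mul_one, one_mul]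
      rw [← h]; ring
    | succ b ihb =>
      obtain ⟨f, hf⟩ := ihb
      obtain ⟨g, hg⟩ := ihd (b + 1)
      refine ⟨f + 4 * g, ?_⟩
      rw [show b + (d + 1) = b + d + 1 by ring, show 2 * (b + d + 1) = 2 * (b + d) + 1 + 1 by ring]
        at hf
      rw [show b + 1 + d = b + d + 1 by ring, show 2 * (b + d + 1) = 2 * (b + d) + 1 + 1 by ring,
        show 2 * (b + 1) = 2 * b + 1 + 1 by ring] at hg
      rw [show b + 1 + (d + 1) = b + d + 1 + 1 by ring,
        show 2 * (b + d + 1 + 1) = 2 * (b + d) + 1 + 1 + 1 + 1 by ring,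
        show 2 * (b + 1) = 2 * b + 1 + 1 by ring]
      simp only [factorial_succ] at *
      linear_combination
        (2 * b + 1 + 1) * (2 * b + 1) * (b + d + 1 + 1) * hf + 4 * (d + 1) * (b + d + 1 + 1) * hg

open Nat in
/-- If `t = (2(b+d))! b! / ((2b)! (b+d)! d!)`, then `2b+3` divides `d(d-1)t`. -/
theorem dvd_mul_pred_mul (d b t : ℕ)
    (ht : t * ((2 * b)! * (b + d)! * d !) = (2 * (b + d))! * b !) :
    (2 * b + 3) ∣ d * (d - 1) * t := by
  match d with
  | 0 => simp
  | 1 => simp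
  | d + 2 =>
    obtain ⟨f, hf⟩ := exists_mul_factorial_eq d (b + 2)
    refine ⟨4 * (2 * b + 1) * f, ?_⟩
    have hpos : 0 < (2 * b)! * (b + d + 1 + 1)! * d ! := by positivity
    rw [show b + (d + 2) = b + d + 1 + 1 by ring] at ht
    rw [show b + 2 + d = b + d + 1 + 1 by ring,
      show 2 * (b + 2) = 2 * b + 1 + 1 + 1 + 1 by ring] at hf
    have hb : 0 < (b + 1) * (b + 2) := by positivity
    refine Nat.eq_of_mul_eq_mul_right hpos (Nat.eq_of_mul_eq_mul_right hb ?_)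
    rw [show d + 2 - 1 = d + 1 by omega]
    generalize (2 * (b + d + 1 + 1))! = u at *
    generalize (b + d + 1 + 1)! = v at *
    simp only [factorial_succ] at *
    linear_combination (b + 1) * (b + 2) * ht - hf

open Nat in
theorem choose_mul_eq_of_mul_factorial_eq (d b t : ℕ)
    (ht : t * ((2 * b)! * (b + d)! * d !) = (2 * (b + d))! * b !) :
    (2 * b).choose b * t = (2 * (b + d)).choose (b + d) * (b + d).choose b := by
  have h₁ := Nat.choose_mul_factorial_mul_factorial (n := 2 * b) (k := b) (by omega)
  have h₂ := Nat.choose_mul_factorial_mul_factorial (n := 2 * (b + d)) (k := b + d) (by omega)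
  have h₃ := Nat.choose_mul_factorial_mul_factorial (n := b + d) (k := b) (by omega)
  rw [show 2 * b - b = b by omega] at h₁
  rw [show 2 * (b + d) - (b + d) = b + d by omega] at h₂
  rw [show b + d - b = d by omega] at h₃
  have hpos : 0 < b ! * b ! * (b + d)! * d ! := by positivity
  refine Nat.eq_of_mul_eq_mul_right hpos ?_
  have hpos' : 0 < (b + d)! := by positivity
  refine Nat.eq_of_mul_eq_mul_right hpos' ?_
  calc _ = (2 * b).choose b * b ! * b ! * (b + d)! * (t * ((b + d)! * d !)) := by ring
    _ = (b + d)! * (t * ((2 * b)! * (b + d)! * d !)) := by rw [h₁]; ring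
    _ = (b + d)! * ((2 * (b + d))! * b !) := by rw [ht]
    _ = ((b + d).choose b * b ! * d !) *
          (((2 * (b + d)).choose (b + d) * (b + d)! * (b + d)!) * b !) := by rw [h₂, h₃]
    _ = _ := by ring

theorem dvd_three_mul_of_dvd (b n x t : ℤ)
    (h : (2 * b * n + 3) ∣ x * n * (x * n - 1) * t) :
    (2 * b * n + 3) ∣ 3 * x * (3 * x + 2 * b) * t := by
  by_cases h3 : (3 : ℤ) ∣ n
  · obtain ⟨m, rfl⟩ := h3
    have hK : 2 * b * (3 * m) + 3 = 3 * (2 * b * m + 1) := by ring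
    rw [hK] at h ⊢
    have hc : IsCoprime (2 * b * m + 1) m := ⟨1, -(2 * b), by ring⟩
    have h₁ : (2 * b * m + 1) ∣ m * (x * (x * (3 * m) - 1) * t) := by
      refine Int.dvd_of_mul_dvd_mul_left (a := 3) (by norm_num) ?_
      convert h using 1; ring
    obtain ⟨k, hk⟩ := hc.dvd_of_dvd_mul_left h₁
    have h₂ : (2 * b * m + 1) ∣ m * (x * (3 * x + 2 * b) * t) :=
      ⟨k + x * t, by linear_combination hk⟩
    obtain ⟨l, hl⟩ := hc.dvd_of_dvd_mul_left h₂
    exact ⟨l, by linear_combination 3 * hl⟩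
  · have hc : IsCoprime (2 * b * n + 3) n := by
      have : IsCoprime (3 : ℤ) n := (Int.prime_three.coprime_iff_not_dvd).2 h3
      simpa [add_comm, mul_comm] using this.add_mul_left_left (2 * b)
    obtain ⟨k, hk⟩ := h
    have h₁ : (2 * b * n + 3) ∣ n * (n * (x * (3 * x + 2 * b) * t)) :=
      ⟨3 * k + n * x * t, by linear_combination 3 * hk⟩
    obtain ⟨l, hl⟩ := hc.dvd_of_dvd_mul_left (hc.dvd_of_dvd_mul_left h₁)
    exact ⟨3 * l, by linear_combination 3 * hl⟩

theorem div_2bn_add_three (a b n : ℕ) (ha : 0 < a) (hb : 0 < b) (hn : 0 < n) (hab : b < a) :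
    (2 * b * n + 3) * Nat.choose (2 * b * n) (b * n) ∣
      3 * (a - b) * (3 * a - b) * (Nat.choose (2 * a * n) (a * n) * Nat.choose (a * n) (b * n)) := by
  obtain ⟨x, rfl⟩ := Nat.exists_eq_add_of_lt hab
  generalize hy : x + 1 = y
  rw [add_assoc, hy, show b + y - b = y by omega, show 3 * (b + y) - b = 3 * y + 2 * b by omega,
    mul_assoc 2 b n, mul_assoc 2 (b + y) n, add_mul b y n]
  obtain ⟨t, ht⟩ := exists_mul_factorial_eq (y * n) (b * n)
  rw [← choose_mul_eq_of_mul_factorial_eq _ _ _ ht]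
  have h := dvd_mul_pred_mul _ _ _ ht
  have hpos : 1 ≤ y * n := Nat.mul_pos (by omega) hn
  have key : (2 * (b * n) + 3) ∣ 3 * y * (3 * y + 2 * b) * t := by
    zify [hpos] at h ⊢
    rw [← mul_assoc] at h ⊢
    exact dvd_three_mul_of_dvd _ _ _ _ h
  rw [mul_comm (Nat.choose (2 * (b * n)) _) t, ← mul_assoc _ t]
  exact mul_dvd_mul_right key _
end

section
/- Let $a$, $b$ and $n$ be positive integers with $a > b$. Then $(2bn+1)\binom{2bn}{bn}$ divides $3(a-b)(3a-b)\binom{2an}{an}\binom{an}{bn}$. -/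
open Nat in
/-- The quotient `(2b + 2d)! b! / ((b + d)! d! (2b)!) = 4 ^ d * (b + d - 1/2).choose d` is an
integer, by Pascal's rule for the generalized binomial coefficient. -/
lemma factorial_mul_factorial_mul_factorial_two_mul_dvd : ∀ b d : ℕ,
    (b + d)! * d ! * (2 * b)! ∣ (2 * (b + d))! * b !
  | 0, d => by
    simpa [two_mul] using factorial_mul_factorial_dvd_factorial_add d d
  | b + 1, 0 => by simp [mul_comm]
  | b + 1, d + 1 => by
    obtain ⟨s, hs⟩ := factorial_mul_factorial_mul_factorial_two_mul_dvd b (d + 1)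
    obtain ⟨t, ht⟩ := factorial_mul_factorial_mul_factorial_two_mul_dvd (b + 1) d
    refine ⟨s + 4 * t, ?_⟩
    rw [show b + 1 + d = b + d + 1 by ring] at ht
    rw [← add_assoc] at hs
    rw [show b + 1 + (d + 1) = b + d + 1 + 1 by ring,
      show 2 * (b + d + 1 + 1) = 2 * (b + d + 1) + 1 + 1 by ring,
      factorial_succ (2 * (b + d + 1) + 1), factorial_succ (2 * (b + d + 1)),
      factorial_succ (b + d + 1)]
    rw [show 2 * (b + 1) = 2 * b + 1 + 1 by ring, factorial_succ (2 * b + 1),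
      factorial_succ (2 * b), factorial_succ b] at *
    rw [factorial_succ d] at *
    zify at *
    linear_combination ((b : ℤ) + d + 2) * (2 * b + 2) * (2 * b + 1) * hs +
      4 * ((b : ℤ) + d + 2) * (d + 1) * ht

open Nat in
/-- `(2b).choose b` divides `(2(b + d)).choose (b + d) * (b + d).choose b`, with quotient
`(2b + 2d)! b! / ((b + d)! d! (2b)!)`. -/
lemma exists_choose_mul_choose_eq (b d : ℕ) : ∃ t : ℕ,
    (2 * (b + d)).choose (b + d) * (b + d).choose b = (2 * b).choose b * t ∧
      (2 * (b + d))! * b ! = (b + d)! * d ! * (2 * b)! * t := by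
  obtain ⟨t, ht⟩ := factorial_mul_factorial_mul_factorial_two_mul_dvd b d
  refine ⟨t, ?_, ht⟩
  have h1 := add_choose_mul_factorial_mul_factorial (b + d) (b + d)
  have h2 := add_choose_mul_factorial_mul_factorial b d
  rw [← Nat.choose_symm_add] at h2
  have h3 := add_choose_mul_factorial_mul_factorial b b
  rw [← two_mul] at h1 h3
  have hpos : 0 < (b + d)! * b ! * b ! * d ! * (b + d)! := by positivity
  apply Nat.eq_of_mul_eq_mul_right hpos
  zify at *
  linear_combination (((b + d).choose b : ℤ) * b ! * b ! * d !) * h1 +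
    ((2 * (b + d))! * b ! : ℤ) * h2 + ((b + d)! : ℤ) * ht
      - (t * d ! * (b + d)! * (b + d)! : ℤ) * h3

open Nat in
/-- If `n` is coprime to `2b + 1` and `c * n = d + 1`, then, with `a = b + (d + 1)`,
`(2b + 1) * (2b).choose b` divides `c * (2a).choose a * a.choose b`. -/
lemma two_mul_add_one_mul_choose_dvd_of_mul_eq {b c n d : ℕ} (h : c * n = d + 1)
    (hcop : Nat.Coprime (2 * b + 1) n) :
    (2 * b + 1) * (2 * b).choose b ∣
      c * ((2 * (b + (d + 1))).choose (b + (d + 1)) * (b + (d + 1)).choose b) := by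
  obtain ⟨t, ht, htf⟩ := exists_choose_mul_choose_eq b (d + 1)
  obtain ⟨u, hu⟩ := factorial_mul_factorial_mul_factorial_two_mul_dvd (b + 1) d
  have key : (d + 1) * t = (2 * b + 1) * (2 * u) := by
    rw [show b + 1 + d = b + (d + 1) by ring, show 2 * (b + 1) = 2 * b + 1 + 1 by ring,
      factorial_succ (2 * b + 1), factorial_succ (2 * b), factorial_succ b] at hu
    rw [factorial_succ d] at htf
    have hpos : 0 < (b + (d + 1))! * d ! * (2 * b)! * (b + 1) := by positivity
    apply Nat.eq_of_mul_eq_mul_right hpos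
    zify at *
    linear_combination hu - ((b : ℤ) + 1) * htf
  have hdvd : 2 * b + 1 ∣ c * t :=
    hcop.dvd_of_dvd_mul_right ⟨2 * u, by rw [← key, ← h]; ring⟩
  rw [ht, mul_left_comm, mul_comm]
  exact mul_dvd_mul_left _ hdvd

theorem div_2bn_add_one (a b n : ℕ) (ha : 0 < a) (hb : 0 < b) (hn : 0 < n) (hab : b < a) :
    (2 * b * n + 1) * Nat.choose (2 * b * n) (b * n) ∣
      3 * (a - b) * (3 * a - b) * (Nat.choose (2 * a * n) (a * n) * Nat.choose (a * n) (b * n)) := by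
  obtain ⟨c, rfl⟩ := Nat.exists_eq_add_of_lt hab
  have hc : b + c + 1 - b = c + 1 := by omega
  obtain ⟨d, hd⟩ : ∃ d, (c + 1) * n = d + 1 := Nat.exists_eq_succ_of_ne_zero (by positivity)
  have hcop : Nat.Coprime (2 * (b * n) + 1) n := by
    rw [← mul_assoc]
    simp
  have h := two_mul_add_one_mul_choose_dvd_of_mul_eq hd hcop
  rw [← hd, ← add_mul, ← add_assoc] at h
  rw [hc, mul_assoc 2 b n, mul_assoc 2 (b + c + 1) n]
  exact h.trans (mul_dvd_mul_right (Dvd.dvd.mul_right (Nat.dvd_mul_left _ 3) _) _)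
end

section
/- Let $a$, $b$ and $n$ be positive integers with $a > b$, let $p \ge 5$ be a prime, and let $i \ge 1$ be an integer such that $p^i \mid 2bn+3$, $p^i \nmid a-b$, and $p^i \nmid 3a-b$. Then $\left\lfloor \frac{2an}{p^i}\right\rfloor + \left\lfloor \frac{bn}{p^i}\right\rfloor - \left\lfloor \frac{an}{p^i}\right\rfloor - \left\lfloor \frac{(a-b)n}{p^i}\right\rfloor - \left\lfloor \frac{2bn}{p^i}\right\rfloor = 1$. -/
theorem Int.floor_natCast_div_eq {N q k r : ℕ} (h : N = q * k + r) (hr : r < q) :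
    ⌊(N : ℚ) / (q : ℚ)⌋ = (k : ℤ) := by
  have hq : (0 : ℚ) < q := by exact_mod_cast (Nat.zero_le r).trans_lt hr
  rw [Int.floor_eq_iff, le_div_iff₀ hq, div_lt_iff₀ hq]
  constructor
  · push_cast
    norm_cast
    nlinarith
  · push_cast
    norm_cast
    nlinarith

theorem floor_identity_of_odd {B C q k : ℕ} (hq : Odd q) (hq3 : 3 ≤ q)
    (hB : 2 * B + 3 = q * k) (h0 : C % q ≠ 0) (h1 : C % q ≠ 1) :
    ⌊((2 * (B + C) : ℕ) : ℚ) / (q : ℚ)⌋ + ⌊(B : ℚ) / (q : ℚ)⌋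
      - ⌊((B + C : ℕ) : ℚ) / (q : ℚ)⌋ - ⌊(C : ℚ) / (q : ℚ)⌋
      - ⌊((2 * B : ℕ) : ℚ) / (q : ℚ)⌋ = 1 := by
  have hk : Odd k := (Nat.odd_mul.1 (hB ▸ (⟨B + 1, by ring⟩ : Odd (2 * B + 3)))).2
  obtain ⟨m, rfl⟩ := hk
  obtain ⟨h, rfl⟩ := hq
  obtain ⟨g, rfl⟩ : ∃ g, h = g + 1 := ⟨h - 1, by omega⟩
  have hr := Nat.mod_lt C (show 0 < 2 * (g + 1) + 1 by omega)
  have hC := (Nat.div_add_mod C (2 * (g + 1) + 1)).symm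
  generalize C % (2 * (g + 1) + 1) = r at *
  generalize C / (2 * (g + 1) + 1) = s at *
  have hB' : B = (2 * (g + 1) + 1) * m + g := by linarith
  rw [Int.floor_natCast_div_eq hB' (by omega), Int.floor_natCast_div_eq hC hr,
    Int.floor_natCast_div_eq (N := 2 * B) (k := 2 * m) (r := 2 * g) (by rw [hB']; ring)
      (by omega)]
  by_cases hlt : g + r < 2 * (g + 1) + 1
  · obtain ⟨t, rfl⟩ : ∃ t, r = t + 2 := ⟨r - 2, by omega⟩
    rw [Int.floor_natCast_div_eq (N := B + C) (k := m + s) (r := g + (t + 2))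
        (by rw [hB', hC]; ring) hlt,
      Int.floor_natCast_div_eq (N := 2 * (B + C)) (k := 2 * (m + s) + 1) (r := 2 * t + 1)
        (by rw [hB', hC]; ring) (by omega)]
    push_cast
    ring
  · obtain ⟨t, rfl⟩ : ∃ t, r = t + (g + 3) := ⟨r - (g + 3), by omega⟩
    rw [Int.floor_natCast_div_eq (N := B + C) (k := m + s + 1) (r := t)
        (by rw [hB', hC]; ring) (by omega),
      Int.floor_natCast_div_eq (N := 2 * (B + C)) (k := 2 * (m + s + 1)) (r := 2 * t)
        (by rw [hB', hC]; ring) (by omega)]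
    push_cast
    ring

theorem floor_identity_p_ge_five (a b n p i : ℕ) (ha : 0 < a) (hb : 0 < b) (hn : 0 < n)
    (hab : b < a) (hp : p.Prime) (hp5 : 5 ≤ p) (hi : 1 ≤ i)
    (hdvd : p ^ i ∣ 2 * b * n + 3) (hab' : ¬ p ^ i ∣ a - b) (h3ab : ¬ p ^ i ∣ 3 * a - b) :
    ⌊(2 * a * n : ℚ) / (p : ℚ) ^ i⌋ + ⌊(b * n : ℚ) / (p : ℚ) ^ i⌋
      - ⌊(a * n : ℚ) / (p : ℚ) ^ i⌋ - ⌊((a : ℚ) - b) * n / (p : ℚ) ^ i⌋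
      - ⌊(2 * b * n : ℚ) / (p : ℚ) ^ i⌋ = 1 := by
  obtain ⟨c, rfl⟩ := Nat.exists_eq_add_of_le hab.le
  have hpq : p ∣ p ^ i := dvd_pow_self p (by omega)
  have hcop : (p ^ i).Coprime n := by
    refine Nat.Coprime.pow_left i ((Nat.Prime.coprime_iff_not_dvd hp).2 fun hpn => ?_)
    have h3 : p ∣ 3 := (Nat.dvd_add_right (hpn.mul_left (2 * b))).1 (hpq.trans hdvd)
    have := Nat.le_of_dvd (by norm_num) h3
    omega
  have hodd : Odd (p ^ i) := (hp.odd_of_ne_two (by omega)).pow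
  have hq5 : 5 ≤ p ^ i := hp5.trans (Nat.le_of_dvd (pow_pos hp.pos i) hpq)
  rw [Nat.add_sub_cancel_left] at hab'
  rw [show 3 * (b + c) - b = 3 * c + 2 * b by omega] at h3ab
  obtain ⟨k, hk⟩ := hdvd
  have h0 : (c * n) % p ^ i ≠ 0 := fun h =>
    hab' (hcop.dvd_of_dvd_mul_right (Nat.dvd_of_mod_eq_zero h))
  have h1 : (c * n) % p ^ i ≠ 1 := fun h => by
    refine h3ab (hcop.dvd_of_dvd_mul_right ⟨3 * (c * n / p ^ i) + k, ?_⟩)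
    have hC := Nat.div_add_mod (c * n) (p ^ i)
    rw [h] at hC
    linarith
  have key := floor_identity_of_odd (B := b * n) hodd (by omega)
    (by rw [← hk]; ring) h0 h1
  push_cast at key ⊢
  simpa only [add_sub_cancel_left, mul_assoc, add_mul] using key
end

section
/- Let $a$, $b$ and $n$ be positive integers with $a > b$ and $9 \nmid n$, and let $i \ge 2$ be an integer such that $3^i \mid 2bn+3$, $3^{i-1} \nmid a-b$, and $3^{i-1} \nmid 3a-b$. Then $\left\lfloor \frac{2an}{3^i}\right\rfloor + \left\lfloor \frac{bn}{3^i}\right\rfloor - \left\lfloor \frac{an}{3^i}\right\rfloor - \left\lfloor \frac{(a-b)n}{3^i}\right\rfloor - \left\lfloor \frac{2bn}{3^i}\right\rfloor = 1$. -/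
theorem three_pow_pred_dvd_of_dvd_mul {x n i : ℕ} (hi : 2 ≤ i) (hn : ¬ 9 ∣ n)
    (h : 3 ^ i ∣ x * n) : 3 ^ (i - 1) ∣ x := by
  obtain ⟨j, rfl⟩ : ∃ j, i = j + 1 := ⟨i - 1, by omega⟩
  rw [Nat.add_sub_cancel]
  by_cases h3 : 3 ∣ n
  · obtain ⟨m, rfl⟩ := h3
    have hm : ¬ 3 ∣ m := by omega
    have hdvd : 3 ^ j ∣ x * m := by
      refine Nat.dvd_of_mul_dvd_mul_right (k := 3) (by norm_num) ?_
      rw [← pow_succ]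
      convert h using 1
      ring
    exact (((Nat.prime_three.coprime_iff_not_dvd).2 hm).pow_left j).dvd_of_dvd_mul_right hdvd
  · exact (((Nat.prime_three.coprime_iff_not_dvd).2 h3).pow_left j).dvd_of_dvd_mul_right
      ((pow_dvd_pow 3 j.le_succ).trans h)

theorem Rat.floor_div_eq_of_eq_mul_add {x y : ℚ} {q c r : ℤ} (hy : y = q)
    (hx : x = q * c + r) (hr : 0 ≤ r) (hrq : r < q) : ⌊x / y⌋ = c := by
  have hq : (0 : ℚ) < q := by exact_mod_cast hr.trans_lt hrq
  have hr' : (0 : ℚ) ≤ r := by exact_mod_cast hr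
  have hrq' : (r : ℚ) < q := by exact_mod_cast hrq
  rw [Int.floor_eq_iff, hx, hy, le_div_iff₀ hq, div_lt_iff₀ hq]
  constructor <;> linarith

theorem floor_identity_p_eq_three (a b n i : ℕ) (ha : 0 < a) (hb : 0 < b) (hn : 0 < n)
    (hab : b < a) (h9n : ¬ (9 ∣ n)) (hi : 2 ≤ i)
    (hdvd : 3 ^ i ∣ 2 * b * n + 3) (hab' : ¬ 3 ^ (i - 1) ∣ a - b)
    (h3ab : ¬ 3 ^ (i - 1) ∣ 3 * a - b) :
    ⌊(2 * a * n : ℚ) / (3 : ℚ) ^ i⌋ + ⌊(b * n : ℚ) / (3 : ℚ) ^ i⌋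
      - ⌊(a * n : ℚ) / (3 : ℚ) ^ i⌋ - ⌊((a : ℚ) - b) * n / (3 : ℚ) ^ i⌋
      - ⌊(2 * b * n : ℚ) / (3 : ℚ) ^ i⌋ = 1 := by
  have hq9 : 3 ^ 2 ≤ 3 ^ i := Nat.pow_le_pow_right (by norm_num) hi
  have hodd : Odd (3 ^ i) := Odd.pow (by decide)
  have hqQ : (3 : ℚ) ^ i = ((3 ^ i : ℕ) : ℤ) := by push_cast; rfl
  have hA : ¬ 3 ^ i ∣ (a - b) * n := fun h ↦ hab' (three_pow_pred_dvd_of_dvd_mul hi h9n h)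
  have hB : ¬ 3 ^ i ∣ (3 * a - b) * n := fun h ↦ h3ab (three_pow_pred_dvd_of_dvd_mul hi h9n h)
  rw [← Int.natCast_dvd_natCast] at hA hB
  rw [Nat.cast_mul, Nat.cast_sub (by omega)] at hA hB
  generalize 3 ^ i = q at *
  obtain ⟨k, hk⟩ := hdvd
  obtain ⟨s, rfl⟩ := hodd
  have hkodd : Odd k := by
    have : Odd ((2 * s + 1) * k) := by rw [← hk]; exact ⟨b * n + 1, by ring⟩
    exact (Nat.odd_mul.1 this).2
  obtain ⟨w, rfl⟩ := hkodd
  have hbn : (b * n : ℤ) = (2 * s + 1) * w + (s - 1) := by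
    zify at hk
    linarith
  have hdiv := Int.mul_ediv_add_emod (a * n : ℤ) (2 * s + 1)
  have hr0 := Int.emod_nonneg (a * n : ℤ) (b := 2 * s + 1) (by omega)
  have hrq := Int.emod_lt_of_pos (a * n : ℤ) (b := 2 * s + 1) (by omega)
  generalize (a * n : ℤ) / (2 * s + 1) = u at *
  generalize (a * n : ℤ) % (2 * s + 1) = r at *
  have hne₁ : r ≠ s - 1 := fun h ↦ hA ⟨u - w, by
    push_cast; subst h; linear_combination -hdiv - hbn⟩
  have hne₂ : r ≠ s := fun h ↦ hB ⟨3 * u - w + 1, by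
    push_cast; subst h; linear_combination -3 * hdiv - hbn⟩
  have hbnQ : (b * n : ℚ) = (2 * s + 1) * w + (s - 1) := by exact_mod_cast hbn
  have hanQ : (a * n : ℚ) = (2 * s + 1) * u + r := by exact_mod_cast hdiv.symm
  rw [Rat.floor_div_eq_of_eq_mul_add (x := b * n) (c := w) (r := s - 1) hqQ
      (by push_cast; linarith) (by omega) (by omega),
    Rat.floor_div_eq_of_eq_mul_add (x := a * n) (c := u) (r := r) hqQ
      (by push_cast; linarith) (by omega) (by omega),
    Rat.floor_div_eq_of_eq_mul_add (x := 2 * b * n) (c := 2 * w) (r := 2 * (s - 1)) hqQ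
      (by push_cast; linarith) (by omega) (by omega)]
  rcases lt_or_ge r (s : ℤ) with hlt | hge
  · rw [Rat.floor_div_eq_of_eq_mul_add (x := 2 * a * n) (c := 2 * u) (r := 2 * r) hqQ
        (by push_cast; linarith) (by omega) (by omega),
      Rat.floor_div_eq_of_eq_mul_add (x := (a - b) * n) (c := u - w - 1) (r := r + s + 2) hqQ
        (by push_cast; linarith) (by omega) (by omega)]
    ring
  · rw [Rat.floor_div_eq_of_eq_mul_add (x := 2 * a * n) (c := 2 * u + 1)
        (r := 2 * r - (2 * s + 1)) hqQ (by push_cast; linarith) (by omega) (by omega),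
      Rat.floor_div_eq_of_eq_mul_add (x := (a - b) * n) (c := u - w) (r := r - (s - 1)) hqQ
        (by push_cast; linarith) (by omega) (by omega)]
    ring
end

section
/- Let $a$, $b$ and $n$ be positive integers with $a > b$, and let $p \ge 5$ be a prime. Then $\nu_p\!\left(\binom{2an}{an}\binom{an}{bn}\right) + \max\{\nu_p(a-b),\ \nu_p(3a-b)\} \ \ge\ \nu_p\!\left(\binom{2bn}{bn}\right) + \nu_p(2bn+3)$. -/
/-- Termwise form of the integrality of `(2A)! B! / (A! (A - B)! (2B)!)`, with `A = D + B`. -/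
lemma div_add_div_add_div_le (D B q : ℕ) (hq : 0 < q) :
    (D + B) / q + D / q + 2 * B / q ≤ 2 * (D + B) / q + B / q := by
  have h1 := Nat.add_div (a := D) (b := B) hq
  have h2 := Nat.add_div (a := B) (b := B) hq
  have h3 := Nat.add_div (a := D + B) (b := D + B) hq
  have h4 := Nat.add_mod_eq_ite (m := D) (n := B) (k := q)
  have := Nat.mod_lt D hq
  have := Nat.mod_lt B hq
  rw [← two_mul] at h2 h3
  split_ifs at * <;> omega

/-- If `q` divides `2B + 3`, the termwise inequality is strict unless `A = D + B` is congruent to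
`B` or `B + 1` modulo `q`. -/
lemma div_add_div_add_div_lt (D B q : ℕ) (hq : 5 ≤ q) (hB : q ∣ 2 * B + 3)
    (h0 : ¬ q ∣ D) (h1 : ¬ q ∣ 3 * D + 2 * B) :
    (D + B) / q + D / q + 2 * B / q + 1 ≤ 2 * (D + B) / q + B / q := by
  have hq0 : 0 < q := by omega
  have hd := Nat.mod_lt D hq0
  have hy := Nat.mod_lt B hq0
  have hy3 : 2 * (B % q) + 3 = q := by
    have h : q ∣ 2 * (B % q) + 3 := by
      have e : 2 * B + 3 = q * (2 * (B / q)) + (2 * (B % q) + 3) := by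
        linarith [Nat.div_add_mod B q]
      rw [e] at hB
      exact (Nat.dvd_add_right (dvd_mul_right _ _)).1 hB
    obtain ⟨k, hk⟩ := h
    have : k < 3 := by
      by_contra! hc
      nlinarith
    interval_cases k <;> omega
  have hd0 : D % q ≠ 0 := fun h => h0 (Nat.dvd_of_mod_eq_zero h)
  have hd1 : D % q ≠ 1 := by
    intro h
    apply h1
    have e : 3 * D + 2 * B = q * (3 * (D / q) + 2 * (B / q) + 1) := by
      have := Nat.div_add_mod B q
      have := Nat.div_add_mod D q
      rw [h] at this
      linarith
    exact ⟨_, e⟩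
  have e1 := Nat.add_div (a := D) (b := B) hq0
  have e2 := Nat.add_div (a := B) (b := B) hq0
  have e3 := Nat.add_div (a := D + B) (b := D + B) hq0
  have e4 := Nat.add_mod_eq_ite (m := D) (n := B) (k := q)
  rw [← two_mul] at e2 e3
  split_ifs at * <;> omega

/-- The quotient of binomial coefficients has the valuation of `(2A)! B! / (A! (A - B)! (2B)!)`,
where `A = D + B`. -/
lemma padicValNat_choose_mul_choose (p D B : ℕ) [Fact p.Prime] :
    padicValNat p ((2 * (D + B)).choose (D + B) * (D + B).choose B) +
        (padicValNat p (D + B).factorial + padicValNat p D.factorial +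
          padicValNat p (2 * B).factorial) =
      padicValNat p ((2 * B).choose B) +
        (padicValNat p (2 * (D + B)).factorial + padicValNat p B.factorial) := by
  have hc : ∀ X Y : ℕ, padicValNat p ((X + Y).choose Y) + padicValNat p X.factorial +
      padicValNat p Y.factorial = padicValNat p (X + Y).factorial := by
    intro X Y
    have hne := (Nat.choose_pos (Nat.le_add_left Y X)).ne'
    rw [← Nat.add_choose_mul_factorial_mul_factorial X Y,
      padicValNat.mul (mul_ne_zero hne X.factorial_ne_zero) Y.factorial_ne_zero,
      padicValNat.mul hne X.factorial_ne_zero]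
  have h1 := hc D B
  have h2 := hc B B
  have h3 := hc (D + B) (D + B)
  rw [padicValNat.mul (Nat.choose_pos (by omega)).ne' (Nat.choose_pos (by omega)).ne']
  simp only [← two_mul] at h2 h3
  omega

theorem valuation_ineq_p_ge_five (a b n p : ℕ) (ha : 0 < a) (hb : 0 < b) (hn : 0 < n)
    (hab : b < a) (hp : p.Prime) (hp5 : 5 ≤ p) :
    padicValNat p (Nat.choose (2 * b * n) (b * n)) + padicValNat p (2 * b * n + 3) ≤
      padicValNat p (Nat.choose (2 * a * n) (a * n) * Nat.choose (a * n) (b * n)) +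
        max (padicValNat p (a - b)) (padicValNat p (3 * a - b)) := by
  have : Fact p.Prime := ⟨hp⟩
  obtain ⟨d, rfl⟩ : ∃ d, a = d + b := ⟨a - b, by omega⟩
  have hd : d ≠ 0 := by omega
  rw [show d + b - b = d by omega, show 3 * (d + b) - b = 3 * d + 2 * b by omega, mul_assoc,
    mul_assoc, add_mul]
  set M := max (padicValNat p d) (padicValNat p (3 * d + 2 * b)) with hM
  set s := padicValNat p (2 * (b * n) + 3) with hs
  have key := padicValNat_choose_mul_choose p (d * n) (b * n)
  set N := 2 * (d * n + b * n) + s + 1 with hN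
  have hlog : ∀ X ≤ 2 * (d * n + b * n), Nat.log p X < N := fun X hX => by
    have := Nat.log_le_self p X
    omega
  have hsum : ∑ i ∈ Finset.Ico 1 N, ((d * n + b * n) / p ^ i + d * n / p ^ i +
        2 * (b * n) / p ^ i + if i ∈ Finset.Ioc M s then 1 else 0) ≤
      ∑ i ∈ Finset.Ico 1 N, (2 * (d * n + b * n) / p ^ i + b * n / p ^ i) := by
    refine Finset.sum_le_sum fun i hi => ?_
    have hi1 := (Finset.mem_Ico.1 hi).1
    split_ifs with h
    · obtain ⟨hMi, his⟩ := Finset.mem_Ioc.1 h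
      have hdvd : p ^ i ∣ 2 * (b * n) + 3 := (pow_dvd_pow p his).trans pow_padicValNat_dvd
      have hpn : ¬ p ∣ n := fun hpn => by
        have h3 : p ∣ 3 := (Nat.dvd_add_right ((hpn.mul_left b).mul_left 2)).1
          ((dvd_pow_self p (by omega)).trans hdvd)
        have := Nat.le_of_dvd (by norm_num) h3
        omega
      have hcop : (p ^ i).Coprime n := ((Nat.Prime.coprime_iff_not_dvd hp).2 hpn).pow_left i
      refine div_add_div_add_div_lt _ _ _ (hp5.trans (Nat.le_self_pow (by omega) p)) hdvd ?_ ?_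
      · intro h
        have := (padicValNat_dvd_iff_le hd).1 (hcop.dvd_of_dvd_mul_right h)
        omega
      · rw [show 3 * (d * n) + 2 * (b * n) = (3 * d + 2 * b) * n by ring]
        intro h
        have := (padicValNat_dvd_iff_le (by omega)).1 (hcop.dvd_of_dvd_mul_right h)
        omega
    · exact div_add_div_add_div_le _ _ _ (pow_pos hp.pos i)
  have hcard : s - M ≤ ∑ i ∈ Finset.Ico 1 N, if i ∈ Finset.Ioc M s then 1 else 0 := by
    rw [← Finset.card_filter, ← Nat.card_Ioc]
    refine Finset.card_le_card fun i hi => Finset.mem_filter.2 ⟨?_, hi⟩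
    rw [Finset.mem_Ioc] at hi
    rw [Finset.mem_Ico]
    omega
  simp only [Finset.sum_add_distrib] at hsum
  rw [padicValNat_factorial (hlog _ (by omega)), padicValNat_factorial (hlog _ (by omega)),
    padicValNat_factorial (hlog _ (by omega)), padicValNat_factorial (hlog _ (by omega)),
    padicValNat_factorial (hlog _ (by omega))] at key
  omega
end

section
/- Let $a$, $b$ and $n$ be positive integers with $a > b$. Then $\nu_3\!\left(\binom{2an}{an}\binom{an}{bn}\right) + \max\{\nu_3(a-b),\ \nu_3(3a-b)\} + 1 \ \ge\ \nu_3\!\left(\binom{2bn}{bn}\right) + \nu_3(2bn+3)$. -/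
/-- With `x = q * (x / q) + x % q`, doubling carries exactly when `q ≤ 2 * (x % q)`. -/
theorem two_mul_div_eq (q x : ℕ) (hq : 0 < q) :
    (2 * x / q = 2 * (x / q) ∧ 2 * (x % q) < q) ∨
      (2 * x / q = 2 * (x / q) + 1 ∧ q ≤ 2 * (x % q)) := by
  have hx := Nat.div_add_mod x q
  have hlt := Nat.mod_lt x hq
  rcases lt_or_ge (2 * (x % q)) q with h | h
  · refine Or.inl ⟨?_, h⟩
    apply Nat.div_eq_of_lt_le <;> nlinarith [Nat.zero_le (x % q)]
  · refine Or.inr ⟨?_, h⟩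
    apply Nat.div_eq_of_lt_le <;> nlinarith [Nat.zero_le (x % q)]

theorem div_add_div_sub_eq (q A B : ℕ) (hq : 0 < q) (hBA : B ≤ A) :
    (B / q + (A - B) / q = A / q ∧ B % q ≤ A % q) ∨
      (B / q + (A - B) / q + 1 = A / q ∧ A % q < B % q) := by
  obtain ⟨d, rfl⟩ := Nat.exists_eq_add_of_le hBA
  rw [Nat.add_sub_cancel_left, Nat.add_div hq, Nat.add_mod B d q]
  have hB := Nat.mod_lt B hq
  have hd := Nat.mod_lt d hq
  split_ifs with h
  · have hm : (B % q + d % q) % q = B % q + d % q - q := by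
      rw [Nat.mod_eq_sub_mod h]
      exact Nat.mod_eq_of_lt (by omega)
    omega
  · have hm : (B % q + d % q) % q = B % q + d % q := Nat.mod_eq_of_lt (by omega)
    omega

theorem div_add_two_mul_div_add_sub_div_le (q A B : ℕ) (hq : 0 < q) (hBA : B ≤ A) :
    A / q + 2 * B / q + (A - B) / q ≤ 2 * A / q + B / q := by
  rcases two_mul_div_eq q A hq with h₁ | h₁ <;> rcases two_mul_div_eq q B hq with h₂ | h₂ <;>
    rcases div_add_div_sub_eq q A B hq hBA with h₃ | h₃ <;> omega

theorem div_add_two_mul_div_add_sub_div_lt (q A B : ℕ) (hq : 3 < q) (hodd : Odd q)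
    (hBA : B ≤ A) (hdvd : q ∣ 2 * B + 3) (h₁ : ¬ q ∣ A - B) (h₂ : ¬ q ∣ 3 * A - B) :
    A / q + 2 * B / q + (A - B) / q < 2 * A / q + B / q := by
  have hq0 : 0 < q := by omega
  have hB := Nat.mod_lt B hq0
  have hy : 2 * (B % q) + 3 = q := by
    have h : q ∣ 2 * (B % q) + 3 := by
      have h' : q ∣ q * (2 * (B / q)) + (2 * (B % q) + 3) := by
        convert hdvd using 1
        nlinarith [Nat.div_add_mod B q]
      exact (Nat.dvd_add_right (dvd_mul_right _ _)).1 h'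
    obtain ⟨c, hc⟩ := h
    obtain ⟨r, hr⟩ := hodd
    have hc3 : c < 3 := by
      by_contra! h3
      nlinarith
    interval_cases c <;> omega
  have hne : A % q ≠ B % q := fun h => h₁ ((Nat.modEq_iff_dvd' hBA).1 h.symm)
  have hne' : A % q ≠ B % q + 1 := by
    intro h
    refine h₂ ((Nat.modEq_iff_dvd' (by omega)).1 ?_)
    have hA : 3 * A ≡ 3 * (B % q + 1) [MOD q] := by
      rw [← h]
      exact (Nat.mod_modEq A q).symm.mul_left 3
    have hs : 3 * (B % q + 1) = B % q + q := by omega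
    rw [hs] at hA
    exact (hA.trans (by simp [Nat.ModEq])).symm
  rcases two_mul_div_eq q A hq0 with h₃ | h₃ <;> rcases two_mul_div_eq q B hq0 with h₄ | h₄ <;>
    rcases div_add_div_sub_eq q A B hq0 hBA with h₅ | h₅ <;> omega

theorem choose_mul_choose_mul_factorials (A B : ℕ) (hBA : B ≤ A) :
    (2 * A).choose A * A.choose B * (A.factorial * (2 * B).factorial * (A - B).factorial) =
      (2 * B).choose B * ((2 * A).factorial * B.factorial) := by
  have h₁ := Nat.choose_mul_factorial_mul_factorial (show A ≤ 2 * A by omega)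
  have h₂ := Nat.choose_mul_factorial_mul_factorial hBA
  have h₃ := Nat.choose_mul_factorial_mul_factorial (show B ≤ 2 * B by omega)
  rw [show 2 * A - A = A by omega] at h₁
  rw [show 2 * B - B = B by omega] at h₃
  rw [← h₁, ← h₃]
  calc
    _ = (2 * A).choose A * A.factorial * (2 * B).choose B * B.factorial *
        (A.choose B * B.factorial * (A - B).factorial) := by ring
    _ = _ := by rw [h₂]; ring

theorem padicValNat_le_one_of_dvd_two_mul_add_three (b n : ℕ) (hn : 0 < n)
    (h : 9 ∣ 2 * (b * n) + 3) : padicValNat 3 n ≤ 1 := by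
  by_contra! hlt
  have h9 : 3 ^ 2 ∣ n := (padicValNat_dvd_iff_le hn.ne').2 hlt
  have : 9 ∣ b * n := dvd_mul_of_dvd_right h9 b
  omega

theorem le_padicValNat_add_one_of_pow_dvd_mul (c n k : ℕ) (hc : 0 < c) (hn : 0 < n)
    (hv : padicValNat 3 n ≤ 1) (h : 3 ^ k ∣ c * n) : k ≤ padicValNat 3 c + 1 := by
  have hk := (padicValNat_dvd_iff_le (mul_pos hc hn).ne').1 h
  rw [padicValNat.mul hc.ne' hn.ne'] at hk
  omega

theorem valuation_ineq_p_eq_three (a b n : ℕ) (ha : 0 < a) (hb : 0 < b) (hn : 0 < n)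
    (hab : b < a) :
    padicValNat 3 (Nat.choose (2 * b * n) (b * n)) + padicValNat 3 (2 * b * n + 3) ≤
      padicValNat 3 (Nat.choose (2 * a * n) (a * n) * Nat.choose (a * n) (b * n)) +
        max (padicValNat 3 (a - b)) (padicValNat 3 (3 * a - b)) + 1 := by
  rw [mul_assoc 2 b n, mul_assoc 2 a n]
  set m := max (padicValNat 3 (a - b)) (padicValNat 3 (3 * a - b)) with hm
  have hBA : b * n ≤ a * n := Nat.mul_le_mul_right n hab.le
  set s := padicValNat 3 (2 * (b * n) + 3) with hs
  have hsdvd : ∀ k ≤ s, 3 ^ k ∣ 2 * (b * n) + 3 := fun k hk =>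
    (padicValNat_dvd_iff_le (by omega)).2 hk
  have hterm : ∀ k, a * n / 3 ^ k + 2 * (b * n) / 3 ^ k + (a * n - b * n) / 3 ^ k +
      (if k ∈ Finset.Ico (m + 2) (s + 1) then 1 else 0) ≤
      2 * (a * n) / 3 ^ k + b * n / 3 ^ k := by
    intro k
    split_ifs with hk
    · rw [Finset.mem_Ico] at hk
      have h9 : 3 ^ 2 ≤ 3 ^ k := Nat.pow_le_pow_right (by norm_num) (by omega)
      have hv := padicValNat_le_one_of_dvd_two_mul_add_three b n hn (hsdvd 2 (by omega))
      refine div_add_two_mul_div_add_sub_div_lt _ _ _ (by omega) (Odd.pow (by decide)) hBA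
        (hsdvd k (by omega)) (fun h => ?_) (fun h => ?_)
      · rw [← Nat.sub_mul] at h
        have := le_padicValNat_add_one_of_pow_dvd_mul _ n k (by omega) hn hv h
        omega
      · rw [← mul_assoc, ← Nat.sub_mul] at h
        have := le_padicValNat_add_one_of_pow_dvd_mul _ n k (by omega) hn hv h
        omega
    · exact div_add_two_mul_div_add_sub_div_le _ _ _ (by positivity) hBA
  set N := Nat.log 3 (2 * (a * n)) + s + 1 with hN
  have hlog : ∀ x ≤ 2 * (a * n), padicValNat 3 x.factorial = ∑ k ∈ Finset.Ico 1 N, x / 3 ^ k :=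
    fun x hx => padicValNat_factorial (by have := Nat.log_mono_right (b := 3) hx; omega)
  have hsum := Finset.sum_le_sum fun k (_ : k ∈ Finset.Ico 1 N) => hterm k
  simp only [Finset.sum_add_distrib] at hsum
  rw [← hlog _ (by omega), ← hlog _ (by omega), ← hlog _ (by omega), ← hlog _ le_rfl,
    ← hlog _ (by omega), Finset.sum_ite_mem, Finset.inter_eq_right.2 (by
      intro k hk
      rw [Finset.mem_Ico] at hk ⊢
      omega)] at hsum
  simp only [Finset.sum_const, Nat.card_Ico, smul_eq_mul, mul_one] at hsum
  have hval := congrArg (padicValNat 3) (choose_mul_choose_mul_factorials _ _ hBA)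
  have hc₁ : (2 * (a * n)).choose (a * n) * (a * n).choose (b * n) ≠ 0 :=
    mul_ne_zero (Nat.choose_pos (by omega)).ne' (Nat.choose_pos hBA).ne'
  have hc₂ : (2 * (b * n)).choose (b * n) ≠ 0 := (Nat.choose_pos (by omega)).ne'
  have hf := Nat.factorial_ne_zero
  rw [padicValNat.mul hc₁ (mul_ne_zero (mul_ne_zero (hf _) (hf _)) (hf _)),
    padicValNat.mul (mul_ne_zero (hf _) (hf _)) (hf _), padicValNat.mul (hf _) (hf _),
    padicValNat.mul hc₂ (mul_ne_zero (hf _) (hf _)), padicValNat.mul (hf _) (hf _)] at hval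
  omega
end

section
/- For every positive integer $n$, the quantity $t_n = \dfrac{\binom{15n}{5n}\binom{5n-1}{n-1}}{(10n+1)\binom{3n}{n}}$ satisfies $21 t_n \equiv 0 \pmod{10n+3}$; equivalently, $(10n+1)(10n+3)\binom{3n}{n}$ divides $21\binom{15n}{5n}\binom{5n-1}{n-1}$. -/
theorem floor_sum_le_of_lt {r q : ℕ} (hr : r < q) :
    10 * r / q + 4 * r / q + 3 * r / q ≤ 15 * r / q + 2 * r / q := by
  have hq : 0 < q := by omega
  have ha := Nat.lt_mul_div_succ (15 * r) hq
  have hb := Nat.lt_mul_div_succ (2 * r) hq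
  have hb' := Nat.mul_div_le (2 * r) q
  have hc := Nat.mul_div_le (10 * r) q
  have hd := Nat.mul_div_le (4 * r) q
  have he := Nat.mul_div_le (3 * r) q
  generalize 15 * r / q = a at *
  generalize 2 * r / q = b at *
  generalize 10 * r / q = c at *
  generalize 4 * r / q = d at *
  generalize 3 * r / q = e at *
  have : c < 10 := by nlinarith
  have : d < 4 := by nlinarith
  have : e < 3 := by nlinarith
  have : b < 2 := by nlinarith
  by_contra! h
  have hs : 15 * r + q * b < q * (c + d + e) := by linarith [Nat.mul_le_mul_left q h]
  clear ha h
  interval_cases c <;> interval_cases d <;> try omega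
  all_goals interval_cases e <;> try omega
  all_goals interval_cases b <;> omega

theorem floor_sum_lt_of_lt {r q j : ℕ} (hr : r < q) (h1 : 1 < q)
    (hj : j = 1 ∨ j = 3 ∧ q ≠ 3 ∧ q ≠ 7) (hdvd : q ∣ 10 * r + j) :
    10 * r / q + 4 * r / q + 3 * r / q < 15 * r / q + 2 * r / q := by
  have hq : 0 < q := by omega
  have ha := Nat.lt_mul_div_succ (15 * r) hq
  have hb := Nat.lt_mul_div_succ (2 * r) hq
  have hb' := Nat.mul_div_le (2 * r) q
  have hc := Nat.mul_div_le (10 * r) q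
  have hd := Nat.mul_div_le (4 * r) q
  have he := Nat.mul_div_le (3 * r) q
  obtain ⟨m, hm⟩ := hdvd
  generalize 15 * r / q = a at *
  generalize 2 * r / q = b at *
  generalize 10 * r / q = c at *
  generalize 4 * r / q = d at *
  generalize 3 * r / q = e at *
  have : c < 10 := by nlinarith
  have : d < 4 := by nlinarith
  have : e < 3 := by nlinarith
  have : m < 10 := by
    by_contra! h
    have : q * 10 ≤ q * m := Nat.mul_le_mul_left q h
    omega
  have : b < 2 := by nlinarith
  by_contra! h
  have hs : 15 * r + q * b < q * (c + d + e + 1) := by linarith [Nat.mul_le_mul_left q h]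
  clear ha h
  interval_cases m <;> try omega
  all_goals interval_cases c <;> try omega
  all_goals interval_cases d <;> try omega
  all_goals interval_cases e <;> try omega
  all_goals interval_cases b <;> omega

theorem floor_sum_add_indicators_le {n q : ℕ} (h1 : 1 < q) :
    10 * n / q + 4 * n / q + 3 * n / q + (if q ∣ 10 * n + 1 then 1 else 0) +
        (if q ∣ 10 * n + 3 then 1 else 0) ≤
      15 * n / q + 2 * n / q + (if q ∣ 21 then 1 else 0) := by
  have hq : 0 < q := by omega
  have hr := Nat.mod_lt n hq
  have hdiv (k : ℕ) : k * n / q = k * (n / q) + k * (n % q) / q := by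
    conv_lhs => rw [← Nat.div_add_mod n q]
    rw [mul_add, mul_left_comm, Nat.mul_add_div hq]
  have hmod (j : ℕ) : q ∣ 10 * n + j ↔ q ∣ 10 * (n % q) + j := by
    rw [Nat.dvd_iff_mod_eq_zero, Nat.dvd_iff_mod_eq_zero]
    simp [Nat.add_mod, Nat.mul_mod]
  simp only [hdiv, hmod]
  generalize n / q = N
  generalize n % q = r at *
  have hle := floor_sum_le_of_lt hr
  have hnot : ¬ (q ∣ 10 * r + 1 ∧ q ∣ 10 * r + 3) := by
    rintro ⟨ha, hb⟩
    have h := Nat.dvd_sub hb ha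
    rw [show 10 * r + 3 - (10 * r + 1) = 2 by omega] at h
    obtain rfl : q = 2 := le_antisymm (Nat.le_of_dvd two_pos h) h1
    omega
  have hlt₁ := floor_sum_lt_of_lt (j := 1) hr h1 (Or.inl rfl)
  have hlt₃ (h : ¬ q ∣ 21) := floor_sum_lt_of_lt (j := 3) hr h1
    (Or.inr ⟨rfl, by rintro rfl; norm_num at h, by rintro rfl; norm_num at h⟩)
  by_cases ha : q ∣ 10 * r + 1
  · rw [if_pos ha, if_neg fun hb => hnot ⟨ha, hb⟩]
    have := hlt₁ ha
    omega
  · rw [if_neg ha]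
    by_cases hc : q ∣ 21
    · rw [if_pos hc]
      split_ifs <;> omega
    · rw [if_neg hc]
      split_ifs with hb
      · have := hlt₃ hc hb
        omega
      · omega

open Finset in
theorem factorization_eq_sum_indicator {p m b : ℕ} (hp : p.Prime) (hm : 0 < m) (hb : m < p ^ b) :
    m.factorization p = ∑ i ∈ Ico 1 b, if p ^ i ∣ m then 1 else 0 := by
  rw [Nat.factorization_eq_card_pow_dvd_of_lt hp hm hb, card_filter]

open Finset Nat in
theorem factorial_ratio_dvd {n : ℕ} (hn : 0 < n) :
    5 * ((10 * n + 1) * (10 * n + 3)) * ((10 * n)! * (4 * n)! * (3 * n)!) ∣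
      21 * ((15 * n)! * (2 * n)!) := by
  have hf (k : ℕ) : k ! ≠ 0 := factorial_ne_zero k
  rw [← factorization_prime_le_iff_dvd (by simp [hf]) (by simp [hf])]
  intro p hp
  have hl : (5 * ((10 * n + 1) * (10 * n + 3)) * ((10 * n)! * (4 * n)! * (3 * n)!)).factorization p =
      (5).factorization p + (10 * n + 1).factorization p + (10 * n + 3).factorization p +
        ((10 * n)!.factorization p + (4 * n)!.factorization p + (3 * n)!.factorization p) := by
    simp [factorization_mul, hf, add_assoc]
  have hr : (21 * ((15 * n)! * (2 * n)!)).factorization p =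
      (21).factorization p + ((15 * n)!.factorization p + (2 * n)!.factorization p) := by
    simp [factorization_mul, hf]
  rw [hl, hr]
  by_cases h5 : p = 5
  · subst h5
    have h15 := factorization_factorial_mul (n := 3 * n) hp
    have h10 := factorization_factorial_mul (n := 2 * n) hp
    have h4 : (5 - 1) * (4 * n)!.factorization 5 < 4 * n := by
      have : Fact (Nat.Prime 5) := ⟨hp⟩
      rw [factorization_def _ hp]
      exact sub_one_mul_padicValNat_factorial_lt_of_ne_zero (p := 5) (by omega)
    rw [← mul_assoc] at h15 h10
    norm_num at h15 h10 h4
    rw [hp.factorization_self, factorization_eq_zero_of_not_dvd (by omega : ¬ 5 ∣ 10 * n + 1),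
      factorization_eq_zero_of_not_dvd (by omega : ¬ 5 ∣ 10 * n + 3)]
    omega
  · have hb (m : ℕ) (hm : m ≤ 15 * n + 21) : m < p ^ (15 * n + 21) :=
      hm.trans_lt (Nat.lt_pow_self hp.one_lt)
    have hlog (m : ℕ) (hm : m ≤ 15 * n + 21) : log p m < 15 * n + 21 :=
      Nat.log_lt_of_lt_pow' (by omega) (hb m hm)
    rw [factorization_eq_zero_of_not_dvd (n := 5) (p := p)
        (by rwa [prime_dvd_prime_iff_eq hp prime_five]),
      factorization_eq_sum_indicator hp (by omega) (hb (10 * n + 1) (by omega)),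
      factorization_eq_sum_indicator hp (by omega) (hb (10 * n + 3) (by omega)),
      factorization_eq_sum_indicator hp (by omega) (hb 21 (by omega)),
      factorization_factorial hp (hlog (10 * n) (by omega)),
      factorization_factorial hp (hlog (4 * n) (by omega)),
      factorization_factorial hp (hlog (3 * n) (by omega)),
      factorization_factorial hp (hlog (15 * n) (by omega)),
      factorization_factorial hp (hlog (2 * n) (by omega))]
    simp only [zero_add, ← sum_add_distrib]
    refine sum_le_sum fun i hi => ?_
    have hi_pos := (mem_Ico.mp hi).1
    have := floor_sum_add_indicators_le (n := n) (q := p ^ i)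
      (one_lt_pow (by omega) hp.one_lt)
    omega

open Nat in
theorem theorem_B (n : ℕ) (hn : 0 < n) :
    (10 * n + 1) * (10 * n + 3) * Nat.choose (3 * n) n ∣
      21 * (Nat.choose (15 * n) (5 * n) * Nat.choose (5 * n - 1) (n - 1)) := by
  have h15 := choose_mul_factorial_mul_factorial (show 5 * n ≤ 15 * n by omega)
  have h5 := choose_mul_factorial_mul_factorial (show n ≤ 5 * n by omega)
  have h3 := choose_mul_factorial_mul_factorial (show n ≤ 3 * n by omega)
  rw [show 15 * n - 5 * n = 10 * n by omega] at h15
  rw [show 5 * n - n = 4 * n by omega] at h5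
  rw [show 3 * n - n = 2 * n by omega] at h3
  have hc : choose (5 * n) n = 5 * choose (5 * n - 1) (n - 1) := by
    have h := add_one_mul_choose_eq (5 * n - 1) (n - 1)
    rw [show 5 * n - 1 + 1 = 5 * n by omega, show n - 1 + 1 = n by omega] at h
    exact Nat.eq_of_mul_eq_mul_right hn (by linarith)
  have hpos : 0 < 5 * ((10 * n)! * (4 * n)! * (n ! * (2 * n)!)) := by positivity
  have h := factorial_ratio_dvd hn
  rw [← h15, ← h5, ← h3, hc] at h
  refine Nat.dvd_of_mul_dvd_mul_left hpos ?_
  convert h using 1 <;> ring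
end

section
/- For every positive integer $n$, $2(2n+1)\binom{2n}{n}$ divides $\binom{6n}{3n}\binom{3n}{n}$. -/
theorem dvd_prod_add_two_mul_of_odd {d m : ℕ} (hd : Odd d) (hdm : d ∣ m.factorial) (a : ℕ) :
    d ∣ ∏ i ∈ Finset.range m, (a + 2 * i) := by
  obtain ⟨c, rfl⟩ := hd
  have h : ∏ i ∈ Finset.range m, (a + 2 * i) ≡
      ∏ i ∈ Finset.range m, (2 * (a * (c + 1) + i)) [MOD 2 * c + 1] := by
    refine Nat.ModEq.prod fun i _ => ?_
    have : 2 * (a * (c + 1) + i) = (a + 2 * i) + (2 * c + 1) * a := by ring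
    rw [this]
    simp [Nat.ModEq]
  refine (h.dvd_iff dvd_rfl).2 ?_
  rw [Finset.prod_mul_distrib, ← Nat.ascFactorial_eq_prod_range]
  exact (hdm.trans (Nat.factorial_dvd_ascFactorial _ _)).mul_left _

theorem factorial_succ_dvd_two_pow_mul_prod (a m : ℕ) :
    (m + 1).factorial ∣ 2 ^ m * ∏ i ∈ Finset.range (m + 1), (a + 2 * i) := by
  obtain ⟨v, d, hd, h⟩ := Nat.exists_eq_two_pow_mul_odd (Nat.factorial_ne_zero (m + 1))
  have hv : v ≤ m := by
    have hlt := Nat.emultiplicity_two_factorial_lt (Nat.succ_ne_zero m)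
    have hle := le_emultiplicity_of_pow_dvd (Dvd.intro d h.symm)
    have : (v : ℕ∞) < ((m + 1 : ℕ) : ℕ∞) := hle.trans_lt hlt
    have := Nat.cast_lt.1 this
    omega
  rw [h]
  exact mul_dvd_mul (pow_dvd_pow 2 hv)
    (dvd_prod_add_two_mul_of_odd hd (h ▸ Dvd.intro_left _ rfl) a)

theorem prod_odd_mul_factorial (k m : ℕ) :
    (∏ i ∈ Finset.range m, (2 * k + 1 + 2 * i)) * 2 ^ m * (k + m).factorial * (2 * k).factorial =
      (2 * k + 2 * m).factorial * k.factorial := by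
  induction m with
  | zero => simp [mul_comm]
  | succ m ih =>
    rw [Finset.prod_range_succ, ← add_assoc k, Nat.factorial_succ,
      show 2 * k + 2 * (m + 1) = 2 * k + 2 * m + 1 + 1 by ring, Nat.factorial_succ,
      Nat.factorial_succ]
    linear_combination (2 * k + 2 * m + 1 + 1) * (2 * k + 2 * m + 1) * ih

theorem sun_divisibility_one (n : ℕ) (hn : 0 < n) :
    2 * (2 * n + 1) * Nat.choose (2 * n) n ∣
      Nat.choose (6 * n) (3 * n) * Nat.choose (3 * n) n := by
  obtain ⟨k, hk⟩ : ∃ k, 2 * n = k + 2 := ⟨2 * n - 2, by omega⟩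
  obtain ⟨U, hU⟩ := factorial_succ_dvd_two_pow_mul_prod (2 * n + 1) (k + 1)
  obtain ⟨V, hV⟩ := factorial_succ_dvd_two_pow_mul_prod (2 * n + 1 + 2) k
  have hP := prod_odd_mul_factorial n (2 * n)
  have hsplit : ∏ i ∈ Finset.range (k + 1 + 1), (2 * n + 1 + 2 * i) =
      (2 * n + 1) * ∏ i ∈ Finset.range (k + 1), (2 * n + 1 + 2 + 2 * i) := by
    rw [Finset.prod_range_succ', mul_comm]
    congr 1
    exact Finset.prod_congr rfl fun i _ => by ring
  have hUV : 2 * n * U = (2 * n + 1) * (2 * V) := by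
    apply Nat.eq_of_mul_eq_mul_left (Nat.factorial_pos (k + 1))
    rw [hsplit, Nat.factorial_succ, show k + 1 + 1 = 2 * n by omega, pow_succ] at hU
    linear_combination 2 * (2 * n + 1) * hV - hU
  have hdvd : 2 * n + 1 ∣ U :=
    Nat.Coprime.dvd_of_dvd_mul_left (by simp) (Dvd.intro _ hUV.symm)
  have hchoose : Nat.choose (6 * n) (3 * n) * Nat.choose (3 * n) n =
      2 * U * Nat.choose (2 * n) n := by
    have h6 := Nat.choose_mul_factorial_mul_factorial (show 3 * n ≤ 6 * n by omega)
    have h3 := Nat.choose_mul_factorial_mul_factorial (show n ≤ 3 * n by omega)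
    have h2 := Nat.choose_mul_factorial_mul_factorial (show n ≤ 2 * n by omega)
    rw [show 6 * n - 3 * n = 3 * n by omega] at h6
    rw [show 3 * n - n = 2 * n by omega] at h3
    rw [show 2 * n - n = n by omega] at h2
    rw [show n + 2 * n = 3 * n by ring, show 2 * n + 2 * (2 * n) = 6 * n by ring] at hP
    have hU' : (∏ i ∈ Finset.range (2 * n), (2 * n + 1 + 2 * i)) * 2 ^ (2 * n) =
        (2 * n).factorial * (2 * U) := by
      rw [show 2 * n = k + 1 + 1 by omega] at hU ⊢
      rw [pow_succ]
      linear_combination 2 * hU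
    rw [hU'] at hP
    have hpos : 0 < (3 * n).factorial * (3 * n).factorial * (2 * n).factorial *
        n.factorial * n.factorial := by positivity
    apply Nat.eq_of_mul_eq_mul_left hpos
    calc _ = (Nat.choose (6 * n) (3 * n) * (3 * n).factorial * (3 * n).factorial) *
          (Nat.choose (3 * n) n * n.factorial * (2 * n).factorial) * n.factorial := by ring
      _ = (2 * n).factorial * (2 * U) * (3 * n).factorial * (2 * n).factorial *
          (3 * n).factorial := by rw [h6, h3, hP]; ring
      _ = (2 * n).factorial * (2 * U) * (3 * n).factorial *
          (Nat.choose (2 * n) n * n.factorial * n.factorial) * (3 * n).factorial := by rw [h2]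
      _ = _ := by ring
  rw [hchoose]
  exact mul_dvd_mul_right (mul_dvd_mul_left 2 hdvd) _
end

section
/- For every positive integer $n$, $(10n+1)\binom{3n}{n}$ divides $\binom{15n}{5n}\binom{5n-1}{n-1}$. -/
theorem floor_div_add_le (n m : ℕ) (hm : 2 ≤ m) :
    (10 * n + 1) / m + 4 * n / m + 3 * n / m ≤ 15 * n / m + 2 * n / m := by
  have hm0 : 0 < m := by omega
  obtain ⟨q, x, hx, rfl⟩ : ∃ q x, x < m ∧ n = x + m * q :=
    ⟨n / m, n % m, Nat.mod_lt _ hm0, (Nat.mod_add_div n m).symm⟩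
  have h (k c : ℕ) : (k * (x + m * q) + c) / m = (k * x + c) / m + k * q := by
    rw [← Nat.add_mul_div_left _ _ hm0]; congr 1; ring
  have h10 := h 10 1
  have h4 := h 4 0
  have h3 := h 3 0
  have h15 := h 15 0
  have h2 := h 2 0
  simp only [add_zero] at h4 h3 h15 h2
  rw [h10, h4, h3, h15, h2]
  suffices (10 * x + 1) / m + 4 * x / m + 3 * x / m ≤ 15 * x / m + 2 * x / m by omega
  have key (a : ℕ) : ∃ u, a / m = u ∧ m * u ≤ a ∧ a < m * u + m :=
    ⟨a / m, rfl, Nat.mul_div_le a m, Nat.lt_mul_div_succ a hm0⟩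
  obtain ⟨c, hc, hc1, hc2⟩ := key (10 * x + 1)
  obtain ⟨d, hd, hd1, hd2⟩ := key (4 * x)
  obtain ⟨e, he, he1, he2⟩ := key (3 * x)
  rw [hc, hd, he]
  have lo (a u : ℕ) (hu : m * u ≤ a) : u ≤ a / m := (Nat.le_div_iff_mul_le hm0).2 (by linarith)
  have hcb : c < 11 := by nlinarith
  have hdb : d < 4 := by nlinarith
  have heb : e < 3 := by nlinarith
  have l15 := fun u => lo (15 * x) u
  have l2 := fun u => lo (2 * x) u
  by_cases hh : m ≤ 2 * x
  · have := l2 1 (by omega)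
    suffices c + d + e - 1 ≤ 15 * x / m by omega
    apply l15
    interval_cases c <;> interval_cases d <;> interval_cases e <;> omega
  · refine le_trans (l15 (c + d + e) ?_) (Nat.le_add_right _ _)
    interval_cases c <;> interval_cases d <;> interval_cases e <;> omega

open Nat in
theorem factorial_mul_dvd_factorial_mul (n : ℕ) :
    (10 * n + 1)! * (4 * n)! * (3 * n)! ∣ (15 * n)! * (2 * n)! := by
  have ne (k : ℕ) : k ! ≠ 0 := factorial_ne_zero k
  rw [← factorization_prime_le_iff_dvd (mul_ne_zero (mul_ne_zero (ne _) (ne _)) (ne _))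
    (mul_ne_zero (ne _) (ne _))]
  intro p hp
  have : Fact p.Prime := ⟨hp⟩
  simp only [factorization_def _ hp, padicValNat.mul, ne_eq, mul_eq_zero, ne, or_self,
    not_false_eq_true]
  have legendre (k : ℕ) (hk : k ≤ 15 * n + 1) :
      padicValNat p k ! = ∑ i ∈ Finset.Ico 1 (log p (15 * n + 1) + 1), k / p ^ i :=
    padicValNat_factorial (lt_succ_of_le (log_mono_right hk))
  rw [legendre _ (by lia), legendre _ (by lia), legendre _ (by lia), legendre _ (by lia),
    legendre _ (by lia), ← Finset.sum_add_distrib, ← Finset.sum_add_distrib,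
    ← Finset.sum_add_distrib]
  refine Finset.sum_le_sum fun i hi ↦ floor_div_add_le n (p ^ i) ?_
  exact hp.two_le.trans (le_self_pow (by have := Finset.mem_Ico.1 hi; lia) p)

open Nat in
/-- Multiplying both entries of a binomial coefficient by a prime `p` preserves its `p`-adic
valuation. -/
theorem padicValNat_choose_mul_mul {p n k : ℕ} [Fact p.Prime] (hkn : k ≤ n) :
    padicValNat p ((p * n).choose (p * k)) = padicValNat p (n.choose k) := by
  have valuation {a b : ℕ} (h : b ≤ a) :
      padicValNat p (a.choose b) + padicValNat p b ! + padicValNat p (a - b)! =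
        padicValNat p a ! := by
    rw [← choose_mul_factorial_mul_factorial h, padicValNat.mul, padicValNat.mul]
    · exact (choose_pos h).ne'
    · exact factorial_ne_zero b
    · exact mul_ne_zero (choose_pos h).ne' (factorial_ne_zero b)
    · exact factorial_ne_zero _
  have h₁ := valuation hkn
  have h₂ := valuation (Nat.mul_le_mul_left p hkn)
  rw [← Nat.mul_sub] at h₂
  simp only [padicValNat_factorial_mul] at h₂
  lia

open Nat in
theorem dvd_five_mul_choose_mul_choose (n : ℕ) (hn : 0 < n) :
    (10 * n + 1) * (3 * n).choose n ∣
      5 * ((15 * n).choose (5 * n) * (5 * n - 1).choose (n - 1)) := by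
  have h₁ : (3 * n).choose n * n ! * (2 * n)! = (3 * n)! := by
    have := choose_mul_factorial_mul_factorial (show n ≤ 3 * n by lia)
    rwa [show 3 * n - n = 2 * n by lia] at this
  have h₂ : (15 * n).choose (5 * n) * (5 * n)! * (10 * n)! = (15 * n)! := by
    have := choose_mul_factorial_mul_factorial (show 5 * n ≤ 15 * n by lia)
    rwa [show 15 * n - 5 * n = 10 * n by lia] at this
  have h₃ : (5 * n).choose n * n ! * (4 * n)! = (5 * n)! := by
    have := choose_mul_factorial_mul_factorial (show n ≤ 5 * n by lia)
    rwa [show 5 * n - n = 4 * n by lia] at this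
  have h₄ : 5 * (5 * n - 1).choose (n - 1) = (5 * n).choose n := by
    have := add_one_mul_choose_eq (5 * n - 1) (n - 1)
    rw [show 5 * n - 1 + 1 = 5 * n by lia, show n - 1 + 1 = n by lia] at this
    exact Nat.eq_of_mul_eq_mul_right hn (by linarith)
  rw [mul_left_comm, h₄]
  have hpos : 0 < (10 * n)! * (4 * n)! * (3 * n)! := by positivity
  refine Nat.dvd_of_mul_dvd_mul_right hpos ?_
  have hdvd := Nat.mul_dvd_mul_left ((3 * n).choose n) (factorial_mul_dvd_factorial_mul n)
  rw [factorial_succ] at hdvd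
  convert hdvd using 1
  · ring
  · rw [← h₂, ← h₁, ← h₃]
    ring

theorem sun_divisibility_two (n : ℕ) (hn : 0 < n) :
    (10 * n + 1) * Nat.choose (3 * n) n ∣
      Nat.choose (15 * n) (5 * n) * Nat.choose (5 * n - 1) (n - 1) := by
  have h₁ : (3 * n).choose n ≠ 0 := (Nat.choose_pos (by lia)).ne'
  have h₂ : (15 * n).choose (5 * n) ≠ 0 := (Nat.choose_pos (by lia)).ne'
  have h₃ : (5 * n - 1).choose (n - 1) ≠ 0 := (Nat.choose_pos (by lia)).ne'
  have hdvd := dvd_five_mul_choose_mul_choose n hn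
  rw [← Nat.factorization_prime_le_iff_dvd (by positivity) (by positivity)] at hdvd ⊢
  intro p hp
  have : Fact p.Prime := ⟨hp⟩
  rcases eq_or_ne p 5 with rfl | hp5
  · simp only [Nat.factorization_def _ hp]
    rw [padicValNat.mul (by lia) h₁, padicValNat.mul h₂ h₃,
      padicValNat.eq_zero_of_not_dvd (show ¬ 5 ∣ 10 * n + 1 by lia),
      show 15 * n = 5 * (3 * n) by lia, padicValNat_choose_mul_mul (by lia)]
    lia
  · refine (hdvd p hp).trans_eq ?_
    have hcop : ¬ p ∣ 5 := fun h ↦ hp5 ((Nat.prime_dvd_prime_iff_eq hp Nat.prime_five).1 h)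
    rw [Nat.factorization_mul (by norm_num) (mul_ne_zero h₂ h₃), Finsupp.add_apply,
      Nat.factorization_eq_zero_of_not_dvd hcop, zero_add]
end
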